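/- arXiv:1808.08513 — 2 statements merged into one kernel-verified Lean document; each statement's English description precedes it below -/
import Mathlib

section
/- In a differential linear category, if a map s_R : !R → !R satisfies [ftc.2], then K_R is an isomorphism with inverse K_R⁻¹ = s_R J_R⁻¹ d_R + !(0), and furthermore s_R = K_R⁻¹ d°_R. -/
universe u v

/-- A symmetric strict monoidal category (data and the coherence axioms that
do not require transport along object equalities). Composition `comp f g`
is in diagrammatic order: first `f`, then `g`. -/
structure SMCData where
  Obj : Type u
  Hom : Obj → Obj → Type v
  id : ∀ A : Obj, Hom A A
  comp : ∀ {A B C : Obj}, Hom A B → Hom B C → Hom A C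
  id_comp : ∀ {A B : Obj} (f : Hom A B), comp (id A) f = f
  comp_id : ∀ {A B : Obj} (f : Hom A B), comp f (id B) = f
  comp_assoc : ∀ {A B C D : Obj} (f : Hom A B) (g : Hom B C) (h : Hom C D),
    comp (comp f g) h = comp f (comp g h)
  ten : Obj → Obj → Obj
  unit : Obj
  tHom : ∀ {A B C D : Obj}, Hom A C → Hom B D → Hom (ten A B) (ten C D)
  tHom_id : ∀ (A B : Obj), tHom (id A) (id B) = id (ten A B)
  tHom_comp : ∀ {A₁ A₂ A₃ B₁ B₂ B₃ : Obj} (f : Hom A₁ A₂) (g : Hom A₂ A₃)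
    (f' : Hom B₁ B₂) (g' : Hom B₂ B₃),
    tHom (comp f g) (comp f' g') = comp (tHom f f') (tHom g g')
  tenAssoc : ∀ (A B C : Obj), ten (ten A B) C = ten A (ten B C)
  unit_ten : ∀ (A : Obj), ten unit A = A
  ten_unit : ∀ (A : Obj), ten A unit = A
  sw : ∀ (A B : Obj), Hom (ten A B) (ten B A)
  sw_natural : ∀ {A B C D : Obj} (f : Hom A C) (g : Hom B D),
    comp (tHom f g) (sw C D) = comp (sw A B) (tHom g f)
  sw_sw : ∀ (A B : Obj), comp (sw A B) (sw B A) = id (ten A B)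

/-- The identity morphism transported along an equality of objects. In a
strict monoidal category the structural isomorphisms are identities, so these
are used to express the strictness identifications. -/
def SMCData.cHom (C : SMCData) {A B : C.Obj} (h : A = B) : C.Hom A B := by
  cases h; exact C.id A
/-- A differential linear category: a differential category whose coalgebra modality is a monoidal coalgebra modality. -/
structure DiffLinCat extends SMCData where
  -- strictness coherence: associativity and unit identifications are
  -- (transported) identities compatible with the tensor of morphisms,
  -- and the symmetry satisfies the (strict) hexagon identity
  assoc_natural : ∀ {A₁ A₂ B₁ B₂ C₁ C₂ : Obj} (f : Hom A₁ A₂) (g : Hom B₁ B₂) (h : Hom C₁ C₂),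
    comp (tHom (tHom f g) h) (toSMCData.cHom (tenAssoc A₂ B₂ C₂)) =
      comp (toSMCData.cHom (tenAssoc A₁ B₁ C₁)) (tHom f (tHom g h))
  unit_ten_natural : ∀ {A B : Obj} (f : Hom A B),
    comp (tHom (id unit) f) (toSMCData.cHom (unit_ten B)) =
      comp (toSMCData.cHom (unit_ten A)) f
  ten_unit_natural : ∀ {A B : Obj} (f : Hom A B),
    comp (tHom f (id unit)) (toSMCData.cHom (ten_unit B)) =
      comp (toSMCData.cHom (ten_unit A)) f
  hexagon : ∀ (A B C : Obj),
    comp (toSMCData.cHom (tenAssoc A B C))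
      (comp (tHom (id A) (sw B C))
        (comp (toSMCData.cHom (tenAssoc A C B).symm)
          (comp (tHom (sw A C) (id B)) (toSMCData.cHom (tenAssoc C A B))))) =
      sw (ten A B) C
  -- additive enrichment: hom-sets are commutative monoids and composition
  -- and tensor preserve the additive structure
  add : ∀ {A B : Obj}, Hom A B → Hom A B → Hom A B
  zero : ∀ {A B : Obj}, Hom A B
  add_assoc : ∀ {A B : Obj} (f g h : Hom A B), add (add f g) h = add f (add g h)
  add_comm : ∀ {A B : Obj} (f g : Hom A B), add f g = add g f
  add_zero : ∀ {A B : Obj} (f : Hom A B), add f zero = f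
  comp_add : ∀ {A B C : Obj} (f : Hom A B) (g h : Hom B C),
    comp f (add g h) = add (comp f g) (comp f h)
  add_comp : ∀ {A B C : Obj} (f g : Hom A B) (h : Hom B C),
    comp (add f g) h = add (comp f h) (comp g h)
  comp_zero : ∀ {A B C : Obj} (f : Hom A B), comp f (zero : Hom B C) = zero
  zero_comp : ∀ {A B C : Obj} (f : Hom B C), comp (zero : Hom A B) f = zero
  tHom_add_left : ∀ {A B C D : Obj} (f g : Hom A C) (h : Hom B D),
    tHom (add f g) h = add (tHom f h) (tHom g h)
  tHom_add_right : ∀ {A B C D : Obj} (f : Hom A C) (g h : Hom B D),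
    tHom f (add g h) = add (tHom f g) (tHom f h)
  tHom_zero_left : ∀ {A B C D : Obj} (h : Hom B D),
    tHom (zero : Hom A C) h = zero
  tHom_zero_right : ∀ {A B C D : Obj} (f : Hom A C),
    tHom f (zero : Hom B D) = zero
  -- a coalgebra modality: a comonad (bang, rho, eps) with natural
  -- cocommutative comonoid structure (cmul, cunit) on each bang A,
  -- for which each rho A is a comonoid morphism
  bang : Obj → Obj
  bangMap : ∀ {A B : Obj}, Hom A B → Hom (bang A) (bang B)
  bangMap_id : ∀ (A : Obj), bangMap (id A) = id (bang A)
  bangMap_comp : ∀ {A B C : Obj} (f : Hom A B) (g : Hom B C),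
    bangMap (comp f g) = comp (bangMap f) (bangMap g)
  rho : ∀ (A : Obj), Hom (bang A) (bang (bang A))
  eps : ∀ (A : Obj), Hom (bang A) A
  cmul : ∀ (A : Obj), Hom (bang A) (ten (bang A) (bang A))
  cunit : ∀ (A : Obj), Hom (bang A) unit
  rho_natural : ∀ {A B : Obj} (f : Hom A B),
    comp (bangMap f) (rho B) = comp (rho A) (bangMap (bangMap f))
  eps_natural : ∀ {A B : Obj} (f : Hom A B),
    comp (bangMap f) (eps B) = comp (eps A) f
  cmul_natural : ∀ {A B : Obj} (f : Hom A B),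
    comp (bangMap f) (cmul B) = comp (cmul A) (tHom (bangMap f) (bangMap f))
  cunit_natural : ∀ {A B : Obj} (f : Hom A B),
    comp (bangMap f) (cunit B) = cunit A
  rho_eps : ∀ (A : Obj), comp (rho A) (eps (bang A)) = id (bang A)
  rho_bangMap_eps : ∀ (A : Obj), comp (rho A) (bangMap (eps A)) = id (bang A)
  rho_rho : ∀ (A : Obj), comp (rho A) (rho (bang A)) = comp (rho A) (bangMap (rho A))
  cmul_coassoc : ∀ (A : Obj),
    comp (cmul A) (comp (tHom (cmul A) (id (bang A)))
      (toSMCData.cHom (tenAssoc (bang A) (bang A) (bang A)))) =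
    comp (cmul A) (tHom (id (bang A)) (cmul A))
  cmul_counit_left : ∀ (A : Obj),
    comp (cmul A) (comp (tHom (cunit A) (id (bang A)))
      (toSMCData.cHom (unit_ten (bang A)))) = id (bang A)
  cmul_counit_right : ∀ (A : Obj),
    comp (cmul A) (comp (tHom (id (bang A)) (cunit A))
      (toSMCData.cHom (ten_unit (bang A)))) = id (bang A)
  cmul_cocomm : ∀ (A : Obj), comp (cmul A) (sw (bang A) (bang A)) = cmul A
  rho_cmul : ∀ (A : Obj),
    comp (rho A) (cmul (bang A)) = comp (cmul A) (tHom (rho A) (rho A))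
  rho_cunit : ∀ (A : Obj), comp (rho A) (cunit (bang A)) = cunit A
  -- a deriving transformation [d.1]-[d.5]
  der : ∀ (A : Obj), Hom (ten (bang A) A) (bang A)
  der_natural : ∀ {A B : Obj} (f : Hom A B),
    comp (tHom (bangMap f) f) (der B) = comp (der A) (bangMap f)
  -- [d.1] constant rule
  der_cunit : ∀ (A : Obj), comp (der A) (cunit A) = zero
  -- [d.2] Leibniz rule
  der_cmul : ∀ (A : Obj),
    comp (der A) (cmul A) =
      add
        (comp (tHom (cmul A) (id A))
          (comp (toSMCData.cHom (tenAssoc (bang A) (bang A) A))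
            (comp (tHom (id (bang A)) (sw (bang A) A))
              (comp (toSMCData.cHom (tenAssoc (bang A) A (bang A)).symm)
                (tHom (der A) (id (bang A)))))))
        (comp (tHom (cmul A) (id A))
          (comp (toSMCData.cHom (tenAssoc (bang A) (bang A) A))
            (tHom (id (bang A)) (der A))))
  -- [d.3] linear rule
  der_eps : ∀ (A : Obj),
    comp (der A) (eps A) = comp (tHom (cunit A) (id A)) (toSMCData.cHom (unit_ten A))
  -- [d.4] chain rule
  der_rho : ∀ (A : Obj),
    comp (der A) (rho A) =
      comp (tHom (cmul A) (id A))
        (comp (toSMCData.cHom (tenAssoc (bang A) (bang A) A))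
          (comp (tHom (rho A) (der A)) (der (bang A))))
  -- [d.5] interchange rule
  der_interchange : ∀ (A : Obj),
    comp (tHom (der A) (id A)) (der A) =
      comp (toSMCData.cHom (tenAssoc (bang A) A A))
        (comp (tHom (id (bang A)) (sw A A))
          (comp (toSMCData.cHom (tenAssoc (bang A) A A).symm)
            (comp (tHom (der A) (id A)) (der A))))
  -- monoidal coalgebra modality structure: (bang, m, mUnit) is a symmetric
  -- monoidal functor, rho, eps, cmul, cunit are monoidal transformations and
  -- cmul, cunit are bang-coalgebra morphisms
  m : ∀ (A B : Obj), Hom (ten (bang A) (bang B)) (bang (ten A B))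
  mUnit : Hom unit (bang unit)
  m_natural : ∀ {A A' B B' : Obj} (f : Hom A A') (g : Hom B B'),
    comp (tHom (bangMap f) (bangMap g)) (m A' B') = comp (m A B) (bangMap (tHom f g))
  m_assoc : ∀ (A B C : Obj),
    comp (tHom (m A B) (id (bang C)))
      (comp (m (ten A B) C) (bangMap (toSMCData.cHom (tenAssoc A B C)))) =
    comp (toSMCData.cHom (tenAssoc (bang A) (bang B) (bang C)))
      (comp (tHom (id (bang A)) (m B C)) (m A (ten B C)))
  m_unit_left : ∀ (A : Obj),
    comp (toSMCData.cHom (unit_ten (bang A)).symm)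
      (comp (tHom mUnit (id (bang A)))
        (comp (m unit A) (bangMap (toSMCData.cHom (unit_ten A))))) = id (bang A)
  m_unit_right : ∀ (A : Obj),
    comp (toSMCData.cHom (ten_unit (bang A)).symm)
      (comp (tHom (id (bang A)) mUnit)
        (comp (m A unit) (bangMap (toSMCData.cHom (ten_unit A))))) = id (bang A)
  m_sw : ∀ (A B : Obj),
    comp (sw (bang A) (bang B)) (m B A) = comp (m A B) (bangMap (sw A B))
  m_rho : ∀ (A B : Obj),
    comp (m A B) (rho (ten A B)) =
      comp (tHom (rho A) (rho B)) (comp (m (bang A) (bang B)) (bangMap (m A B)))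
  mUnit_rho : comp mUnit (rho unit) = comp mUnit (bangMap mUnit)
  m_eps : ∀ (A B : Obj), comp (m A B) (eps (ten A B)) = tHom (eps A) (eps B)
  mUnit_eps : comp mUnit (eps unit) = id unit
  m_cmul : ∀ (A B : Obj),
    comp (m A B) (cmul (ten A B)) =
      comp (tHom (cmul A) (cmul B))
        (comp (toSMCData.cHom (tenAssoc (bang A) (bang A) (ten (bang B) (bang B))))
          (comp (tHom (id (bang A)) (toSMCData.cHom (tenAssoc (bang A) (bang B) (bang B)).symm))
            (comp (tHom (id (bang A)) (tHom (sw (bang A) (bang B)) (id (bang B))))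
              (comp (tHom (id (bang A)) (toSMCData.cHom (tenAssoc (bang B) (bang A) (bang B))))
                (comp (toSMCData.cHom (tenAssoc (bang A) (bang B) (ten (bang A) (bang B))).symm)
                  (tHom (m A B) (m A B)))))))
  m_cunit : ∀ (A B : Obj),
    comp (m A B) (cunit (ten A B)) =
      comp (tHom (cunit A) (cunit B)) (toSMCData.cHom (unit_ten unit))
  mUnit_cmul : comp mUnit (cmul unit) =
    comp (toSMCData.cHom (unit_ten unit).symm) (tHom mUnit mUnit)
  mUnit_cunit : comp mUnit (cunit unit) = id unit
  cmul_coalg : ∀ (A : Obj),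
    comp (rho A) (bangMap (cmul A)) =
      comp (cmul A) (comp (tHom (rho A) (rho A)) (m (bang A) (bang A)))
  cunit_coalg : ∀ (A : Obj),
    comp (rho A) (bangMap (cunit A)) = comp (cunit A) mUnit

def DiffLinCat.cHom (C : DiffLinCat) {A B : C.Obj} (h : A = B) : C.Hom A B :=
  C.toSMCData.cHom h

namespace DiffLinCat

variable (C : DiffLinCat)

/-- The coderiving transformation d°_A := Δ_A (1 ⊗ ε_A). -/
def dcirc (A : C.Obj) : C.Hom (C.bang A) (C.ten (C.bang A) A) :=
  C.comp (C.cmul A) (C.tHom (C.id (C.bang A)) (C.eps A))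

/-- K_A := d°_A d_A + !(0). -/
def K (A : C.Obj) : C.Hom (C.bang A) (C.bang A) :=
  C.add (C.comp (C.dcirc A) (C.der A)) (C.bangMap (C.zero : C.Hom A A))

/-- J_A := d°_A d_A + 1_{!A}. -/
def J (A : C.Obj) : C.Hom (C.bang A) (C.bang A) :=
  C.add (C.comp (C.dcirc A) (C.der A)) (C.id (C.bang A))

/-- The deriving transformation at the monoidal unit, under the strictness
identification !R ⊗ R = !R. -/
def dR : C.Hom (C.bang C.unit) (C.bang C.unit) :=
  C.comp (C.cHom (C.ten_unit (C.bang C.unit)).symm) (C.der C.unit)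

/-- The coderiving transformation at the monoidal unit, under the strictness
identification !R ⊗ R = !R. -/
def dcircR : C.Hom (C.bang C.unit) (C.bang C.unit) :=
  C.comp (C.dcirc C.unit) (C.cHom (C.ten_unit (C.bang C.unit)))

end DiffLinCat

open CategoryTheory MonoidalCategory

open scoped ComonObj

namespace CategoryTheory

variable {V : Type*} [Category* V] [MonoidalCategory V]

theorem comul_tensorHom_associator {A X Y Z : V} [ComonObj A] (f : A ⟶ X) (g : A ⟶ Y) (h : A ⟶ Z) :
    Δ[A] ≫ ((Δ[A] ≫ (f ⊗ₘ g)) ⊗ₘ h) ≫ (α_ X Y Z).hom =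
      Δ[A] ≫ (f ⊗ₘ (Δ[A] ≫ (g ⊗ₘ h))) := by
  have e₁ : (Δ[A] ≫ (f ⊗ₘ g)) ⊗ₘ h = Δ[A] ▷ A ≫ ((f ⊗ₘ g) ⊗ₘ h) := by
    rw [← tensorHom_id, tensorHom_comp_tensorHom, Category.id_comp]
  have e₂ : f ⊗ₘ (Δ[A] ≫ (g ⊗ₘ h)) = A ◁ Δ[A] ≫ (f ⊗ₘ g ⊗ₘ h) := by
    rw [← id_tensorHom, tensorHom_comp_tensorHom, Category.id_comp]
  rw [e₁, e₂, Category.assoc, associator_naturality, ComonObj.comul_assoc_assoc]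

variable [SymmetricCategory V] (A B : V) [ComonObj A] [ComonObj B]

instance isCommComonObjTensor [IsCommComonObj A] [IsCommComonObj B] :
    IsCommComonObj (A ⊗ B) where
  comul_comm := by
    rw [Comon.tensorObj_comul, Category.assoc, SymmetricCategory.tensorμ_braid_swap,
      tensorHom_comp_tensorHom_assoc, IsCommComonObj.comul_comm, IsCommComonObj.comul_comm]

/-- The first projection out of a tensor product of comonoids. -/
def comonFst : A ⊗ B ⟶ A := A ◁ ε[B] ≫ (ρ_ A).hom

/-- The second projection out of a tensor product of comonoids. -/
def comonSnd : A ⊗ B ⟶ B := ε[A] ▷ B ≫ (λ_ B).hom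

theorem comonFst_comul : comonFst A B ≫ Δ[A] = Δ[A ⊗ B] ≫ (comonFst A B ⊗ₘ comonFst A B) := by
  have h := tensor_right_unitality A A
  have hB : Δ[B] ≫ (ε[B] ⊗ₘ ε[B]) = ε[B] ≫ (λ_ _).inv :=
    ComonObj.counit_comul_hom _
  have e : Δ[A ⊗ B] ≫ (comonFst A B ⊗ₘ comonFst A B) =
      (Δ[A] ⊗ₘ (Δ[B] ≫ (ε[B] ⊗ₘ ε[B]))) ≫ tensorμ A A (𝟙_ V) (𝟙_ V) ≫
        ((ρ_ A).hom ⊗ₘ (ρ_ A).hom) := by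
    have := tensorμ_natural (𝟙 A) (𝟙 A) ε[B] ε[B]
    simp only [id_tensorHom, whiskerLeft_id] at this
    rw [Comon.tensorObj_comul, comonFst, ← tensorHom_comp_tensorHom, Category.assoc,
      ← reassoc_of% this, ← id_tensorHom, tensorHom_comp_tensorHom_assoc, Category.comp_id]
  rw [e, hB, tensorHom_def', whiskerLeft_comp]
  simp only [Category.assoc, comonFst]
  rw [← rightUnitor_naturality, whisker_exchange_assoc, h]
  simp only [whisker_exchange_assoc]

theorem comul_comonFst_comonSnd : Δ[A ⊗ B] ≫ (comonFst A B ⊗ₘ comonSnd A B) = 𝟙 _ := by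
  have := tensorμ_natural (𝟙 A) ε[A] ε[B] (𝟙 B)
  simp only [id_tensorHom, tensorHom_id] at this
  rw [Comon.tensorObj_comul, comonFst, comonSnd, ← tensorHom_comp_tensorHom, Category.assoc,
      ← reassoc_of% this, tensorHom_comp_tensorHom_assoc, ComonObj.comul_counit,
      ComonObj.counit_comul]
  simp only [tensorμ, braiding_tensorUnit_left]
  monoidal

variable {A} {X Y Z : V}

theorem comul_tensorHom_braiding [IsCommComonObj A] (f : A ⟶ X) (g : A ⟶ Y) :
    Δ[A] ≫ (f ⊗ₘ g) ≫ (β_ X Y).hom = Δ[A] ≫ (g ⊗ₘ f) := by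
  rw [BraidedCategory.braiding_naturality, IsCommComonObj.comul_comm_assoc]

theorem comul_tensorHom_middle_swap [IsCommComonObj A] (f : A ⟶ X) (g : A ⟶ Y) (h : A ⟶ Z) :
    Δ[A] ≫ ((Δ[A] ≫ (f ⊗ₘ g)) ⊗ₘ h) ≫ (α_ X Y Z).hom ≫ X ◁ (β_ Y Z).hom ≫ (α_ X Z Y).inv =
      Δ[A] ≫ ((Δ[A] ≫ (f ⊗ₘ h)) ⊗ₘ g) := by
  rw [reassoc_of% comul_tensorHom_associator f g h, ← id_tensorHom,
    tensorHom_comp_tensorHom_assoc, Category.assoc, comul_tensorHom_braiding, Category.comp_id,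
    ← reassoc_of% comul_tensorHom_associator f h g, Iso.hom_inv_id, Category.comp_id]

end CategoryTheory

namespace SMCData

variable (C : SMCData.{u, v})

theorem cHom_comp_cHom {A B D : C.Obj} (h : A = B) (k : B = D) :
    C.comp (C.cHom h) (C.cHom k) = C.cHom (h.trans k) := by
  subst h k; exact C.id_comp _

theorem tHom_cHom_cHom {A A' B B' : C.Obj} (h : A = A') (k : B = B') :
    C.tHom (C.cHom h) (C.cHom k) = C.cHom (congrArg₂ C.ten h k) := by
  subst h k; exact C.tHom_id _ _

theorem tHom_cHom_id {A A' : C.Obj} (h : A = A') (B : C.Obj) :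
    C.tHom (C.cHom h) (C.id B) = C.cHom (congrArg₂ C.ten h rfl) :=
  C.tHom_cHom_cHom h rfl

theorem tHom_id_cHom {A A' : C.Obj} (h : A = A') (B : C.Obj) :
    C.tHom (C.id B) (C.cHom h) = C.cHom (congrArg₂ C.ten rfl h) :=
  C.tHom_cHom_cHom rfl h

end SMCData

namespace DiffLinCat

variable (C : DiffLinCat.{v, u})

instance category : Category.{v, u} C.Obj where
  Hom := C.Hom
  id := C.id
  comp := C.comp
  id_comp := C.id_comp
  comp_id := C.comp_id
  assoc := C.comp_assoc

/-- The isomorphism given by transporting the identity along an equality of objects. -/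
def castIso {A B : C.Obj} (h : A = B) : A ≅ B where
  hom := C.cHom h
  inv := C.cHom h.symm
  hom_inv_id := C.cHom_comp_cHom h h.symm
  inv_hom_id := C.cHom_comp_cHom h.symm h

instance monoidalStruct : MonoidalCategoryStruct C.Obj where
  tensorObj := C.ten
  whiskerLeft A _ _ f := C.tHom (C.id A) f
  whiskerRight f B := C.tHom f (C.id B)
  tensorHom := C.tHom
  tensorUnit := C.unit
  associator A B D := C.castIso (C.tenAssoc A B D)
  leftUnitor A := C.castIso (C.unit_ten A)
  rightUnitor A := C.castIso (C.ten_unit A)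

instance monoidal : MonoidalCategory C.Obj :=
  MonoidalCategory.ofTensorHom
    (id_tensorHom_id := C.tHom_id)
    (id_tensorHom := fun _ _ _ _ => rfl)
    (tensorHom_id := fun _ _ => rfl)
    (tensorHom_comp_tensorHom := fun f₁ f₂ g₁ g₂ => (C.tHom_comp f₁ g₁ f₂ g₂).symm)
    (associator_naturality := C.assoc_natural)
    (leftUnitor_naturality := C.unit_ten_natural)
    (rightUnitor_naturality := C.ten_unit_natural)
    (pentagon := fun W X Y Z => by
      change C.comp (C.tHom (C.toSMCData.cHom _) (C.id Z))
          (C.comp (C.toSMCData.cHom _) (C.tHom (C.id W) (C.toSMCData.cHom _))) =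
        C.comp (C.toSMCData.cHom _) (C.toSMCData.cHom _)
      simp only [SMCData.tHom_cHom_id, SMCData.tHom_id_cHom, SMCData.cHom_comp_cHom])
    (triangle := fun X Y => by
      change C.comp (C.toSMCData.cHom _) (C.tHom (C.id X) (C.toSMCData.cHom _)) =
        C.tHom (C.toSMCData.cHom _) (C.id Y)
      simp only [SMCData.tHom_cHom_id, SMCData.tHom_id_cHom, SMCData.cHom_comp_cHom])

/-- The symmetry as an isomorphism. -/
def swIso (A B : C.Obj) : A ⊗ B ≅ B ⊗ A where
  hom := C.sw A B
  inv := C.sw B A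
  hom_inv_id := C.sw_sw A B
  inv_hom_id := C.sw_sw B A

theorem swIso_tensor_left (X Y Z : C.Obj) :
    (C.swIso (X ⊗ Y) Z).hom = (α_ X Y Z).hom ≫ X ◁ (C.swIso Y Z).hom ≫ (α_ X Z Y).inv ≫
      (C.swIso X Z).hom ▷ Y ≫ (α_ Z X Y).hom :=
  (C.hexagon X Y Z).symm

theorem swIso_symm (X Y : C.Obj) : C.swIso X Y = (C.swIso Y X).symm := rfl

instance symmetric : SymmetricCategory C.Obj where
  braiding := C.swIso
  braiding_naturality_right X _ _ f := C.sw_natural (C.id X) f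
  braiding_naturality_left f Z := C.sw_natural f (C.id Z)
  hexagon_forward X Y Z := by
    rw [swIso_symm C X (Y ⊗ Z), swIso_symm C X Y, swIso_symm C X Z]
    have h : (C.swIso (Y ⊗ Z) X) = (α_ Y Z X) ≪≫ whiskerLeftIso Y (C.swIso Z X) ≪≫
        (α_ Y X Z).symm ≪≫ whiskerRightIso (C.swIso Y X) Z ≪≫ (α_ X Y Z) :=
      Iso.ext (C.swIso_tensor_left Y Z X)
    rw [h]
    simp
  hexagon_reverse X Y Z := by
    rw [swIso_tensor_left]; simp
  symmetry := C.sw_sw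

instance addHom (A B : C.Obj) : Add (A ⟶ B) := ⟨C.add⟩

instance zeroHom (A B : C.Obj) : Zero (A ⟶ B) := ⟨C.zero⟩

instance addCommMonoidHom (A B : C.Obj) : AddCommMonoid (A ⟶ B) where
  add_assoc := C.add_assoc
  add_comm := C.add_comm
  add_zero := C.add_zero
  zero_add f := (C.add_comm _ _).trans (C.add_zero f)
  nsmul := nsmulRec

section Additive

variable {C} {A B D E : C.Obj}

theorem hom_comp_add (f : A ⟶ B) (g h : B ⟶ D) : f ≫ (g + h) = f ≫ g + f ≫ h :=
  C.comp_add f g h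

theorem hom_add_comp (f g : A ⟶ B) (h : B ⟶ D) : (f + g) ≫ h = f ≫ h + g ≫ h :=
  C.add_comp f g h

theorem hom_comp_zero (f : A ⟶ B) : f ≫ (0 : B ⟶ D) = 0 := C.comp_zero f

theorem hom_zero_comp (f : B ⟶ D) : (0 : A ⟶ B) ≫ f = 0 := C.zero_comp f

theorem tensorHom_zero (f : A ⟶ D) : f ⊗ₘ (0 : B ⟶ E) = 0 := C.tHom_zero_right f

theorem zero_tensorHom (f : B ⟶ E) : (0 : A ⟶ D) ⊗ₘ f = 0 := C.tHom_zero_left f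

theorem hom_add_whiskerRight (f g : A ⟶ D) (B : C.Obj) : (f + g) ▷ B = f ▷ B + g ▷ B :=
  C.tHom_add_left f g (C.id B)

end Additive

instance comonObjBang (A : C.Obj) : ComonObj (C.bang A) where
  counit := C.cunit A
  comul := C.cmul A
  counit_comul := by
    rw [← cancel_mono (λ_ (C.bang A)).hom, Category.assoc, Iso.inv_hom_id]
    exact C.cmul_counit_left A
  comul_counit := by
    rw [← cancel_mono (ρ_ (C.bang A)).hom, Category.assoc, Iso.inv_hom_id]
    exact C.cmul_counit_right A
  comul_assoc := (C.cmul_coassoc A).symm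

instance isCommComonObjBang (A : C.Obj) : IsCommComonObj (C.bang A) where
  comul_comm := C.cmul_cocomm A

section Modality

variable {C}

/-- The functorial action of the modality. -/
def bangHom {A B : C.Obj} (f : A ⟶ B) : C.bang A ⟶ C.bang B := C.bangMap f

variable (C)

/-- The comultiplication of the comonad. -/
def dig (A : C.Obj) : C.bang A ⟶ C.bang (C.bang A) := C.rho A

/-- The counit of the comonad. -/
def derel (A : C.Obj) : C.bang A ⟶ A := C.eps A

/-- The deriving transformation. -/
def deriv (A : C.Obj) : C.bang A ⊗ A ⟶ C.bang A := C.der A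

/-- The binary monoidal structure map of the modality. -/
def mon (A B : C.Obj) : C.bang A ⊗ C.bang B ⟶ C.bang (A ⊗ B) := C.m A B

/-- The nullary monoidal structure map of the modality. -/
def monUnit : 𝟙_ C.Obj ⟶ C.bang (𝟙_ C.Obj) := C.mUnit

variable {C} {A B D E : C.Obj}

theorem bangHom_id (A : C.Obj) : bangHom (𝟙 A) = 𝟙 (C.bang A) := C.bangMap_id A

theorem bangHom_comp (f : A ⟶ B) (g : B ⟶ D) : bangHom (f ≫ g) = bangHom f ≫ bangHom g :=
  C.bangMap_comp f g

theorem bangHom_derel (f : A ⟶ B) : bangHom f ≫ C.derel B = C.derel A ≫ f := C.eps_natural f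

instance isComonHom_bangHom (f : A ⟶ B) : IsComonHom (bangHom f) where
  hom_counit := C.cunit_natural f
  hom_comul := C.cmul_natural f

instance isComonHom_dig (A : C.Obj) : IsComonHom (C.dig A) where
  hom_counit := C.rho_cunit A
  hom_comul := C.rho_cmul A

theorem dig_bangHom_derel (A : C.Obj) : C.dig A ≫ bangHom (C.derel A) = 𝟙 _ :=
  C.rho_bangMap_eps A

theorem deriv_natural (f : A ⟶ B) :
    (bangHom f ⊗ₘ f) ≫ C.deriv B = C.deriv A ≫ bangHom f := C.der_natural f

theorem deriv_counit (A : C.Obj) : C.deriv A ≫ ε[C.bang A] = 0 := C.der_cunit A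

theorem deriv_derel (A : C.Obj) :
    C.deriv A ≫ C.derel A = ε[C.bang A] ▷ A ≫ (λ_ A).hom := C.der_eps A

theorem deriv_comul (A : C.Obj) :
    C.deriv A ≫ Δ[C.bang A] =
      Δ[C.bang A] ▷ A ≫ (α_ _ _ _).hom ≫ C.bang A ◁ (β_ (C.bang A) A).hom ≫ (α_ _ _ _).inv ≫
        C.deriv A ▷ C.bang A +
      Δ[C.bang A] ▷ A ≫ (α_ _ _ _).hom ≫ C.bang A ◁ C.deriv A := C.der_cmul A

theorem deriv_dig (A : C.Obj) :
    C.deriv A ≫ C.dig A =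
      Δ[C.bang A] ▷ A ≫ (α_ _ _ _).hom ≫ (C.dig A ⊗ₘ C.deriv A) ≫ C.deriv (C.bang A) :=
  C.der_rho A

theorem mon_natural (f : A ⟶ B) (g : D ⟶ E) :
    (bangHom f ⊗ₘ bangHom g) ≫ C.mon B E = C.mon A D ≫ bangHom (f ⊗ₘ g) := C.m_natural f g

theorem mon_braiding (A B : C.Obj) :
    (β_ (C.bang A) (C.bang B)).hom ≫ C.mon B A = C.mon A B ≫ bangHom (β_ A B).hom := C.m_sw A B

theorem mon_derel (A B : C.Obj) : C.mon A B ≫ C.derel (A ⊗ B) = C.derel A ⊗ₘ C.derel B :=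
  C.m_eps A B

theorem dig_bangHom_counit (A : C.Obj) :
    C.dig A ≫ bangHom ε[C.bang A] = ε[C.bang A] ≫ C.monUnit := C.cunit_coalg A

theorem dig_bangHom_comul (A : C.Obj) :
    C.dig A ≫ bangHom Δ[C.bang A] = Δ[C.bang A] ≫ (C.dig A ⊗ₘ C.dig A) ≫ C.mon _ _ :=
  C.cmul_coalg A

theorem mon_unit_left (A : C.Obj) :
    (λ_ (C.bang A)).inv ≫ C.monUnit ▷ C.bang A ≫ C.mon (𝟙_ _) A ≫ bangHom (λ_ A).hom = 𝟙 _ :=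
  C.m_unit_left A

theorem mon_unit_right (A : C.Obj) :
    (ρ_ (C.bang A)).inv ≫ C.bang A ◁ C.monUnit ≫ C.mon A (𝟙_ _) ≫ bangHom (ρ_ A).hom = 𝟙 _ :=
  C.m_unit_right A

instance isComonHom_mon (A B : C.Obj) : IsComonHom (C.mon A B) where
  hom_counit := C.m_cunit A B
  hom_comul := by
    rw [Comon.tensorObj_comul, Category.assoc]
    simp only [tensorμ, Category.assoc]
    exact C.m_cmul A B

theorem monUnit_comul : C.monUnit ≫ Δ[C.bang (𝟙_ C.Obj)] =
    (λ_ (𝟙_ C.Obj)).inv ≫ (C.monUnit ⊗ₘ C.monUnit) := C.mUnit_cmul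

theorem monUnit_derel : C.monUnit ≫ C.derel (𝟙_ C.Obj) = 𝟙 _ := C.mUnit_eps

end Modality

section Lie

variable {C} {T X Y : C.Obj} [ComonObj T]

/-- The derivative along `w` of a map `r` out of a comonoid into an exponential. -/
def lie (r : T ⟶ C.bang X) (w : T ⟶ X) : T ⟶ C.bang X := Δ[T] ≫ (r ⊗ₘ w) ≫ C.deriv X

theorem lie_zero (r : T ⟶ C.bang X) : lie r 0 = 0 := by
  rw [lie, tensorHom_zero, hom_zero_comp, hom_comp_zero]

theorem lie_bangHom (r : T ⟶ C.bang X) (w : T ⟶ X) (f : X ⟶ Y) :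
    lie r w ≫ bangHom f = lie (r ≫ bangHom f) (w ≫ f) := by
  rw [lie, lie, Category.assoc, Category.assoc, ← deriv_natural, tensorHom_comp_tensorHom_assoc]

theorem lie_counit (r : T ⟶ C.bang X) (w : T ⟶ X) : lie r w ≫ ε[C.bang X] = 0 := by
  rw [lie, Category.assoc, Category.assoc, deriv_counit, hom_comp_zero, hom_comp_zero]

theorem lie_derel (r : T ⟶ C.bang X) [IsComonHom r] (w : T ⟶ X) :
    lie r w ≫ C.derel X = w := by
  rw [lie, Category.assoc, Category.assoc, deriv_derel, ← tensorHom_id,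
    tensorHom_comp_tensorHom_assoc, IsComonHom.hom_counit, Category.comp_id,
    ComonObj.counit_comul_hom_assoc, Iso.inv_hom_id, Category.comp_id]

theorem comul_tensorHom_comul_whiskerRight (r : T ⟶ C.bang X) [IsComonHom r] (w : T ⟶ X) :
    (r ⊗ₘ w) ≫ Δ[C.bang X] ▷ X = (Δ[T] ≫ (r ⊗ₘ r)) ⊗ₘ w := by
  rw [← tensorHom_id, tensorHom_comp_tensorHom, IsComonHom.hom_comul, Category.comp_id]

theorem lie_comul [IsCommComonObj T] (r : T ⟶ C.bang X) [IsComonHom r] (w : T ⟶ X) :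
    lie r w ≫ Δ[C.bang X] = Δ[T] ≫ (lie r w ⊗ₘ r) + Δ[T] ≫ (r ⊗ₘ lie r w) := by
  rw [lie, Category.assoc, Category.assoc, deriv_comul, hom_comp_add, hom_comp_add,
    reassoc_of% comul_tensorHom_comul_whiskerRight r w,
    reassoc_of% comul_tensorHom_middle_swap r r w,
    reassoc_of% comul_tensorHom_comul_whiskerRight r w,
    reassoc_of% comul_tensorHom_associator r r w,
    ← tensorHom_id, ← id_tensorHom, tensorHom_comp_tensorHom, tensorHom_comp_tensorHom]
  simp only [Category.assoc, Category.comp_id]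

theorem lie_dig (r : T ⟶ C.bang X) [IsComonHom r] (w : T ⟶ X) :
    lie r w ≫ C.dig X = lie (r ≫ C.dig X) (lie r w) := by
  rw [lie, Category.assoc, Category.assoc, deriv_dig,
    reassoc_of% comul_tensorHom_comul_whiskerRight r w,
    reassoc_of% comul_tensorHom_associator r r w, tensorHom_comp_tensorHom_assoc]
  simp only [lie, Category.assoc]

theorem comp_lie {S : C.Obj} [ComonObj S] (f : S ⟶ T) (hf : f ≫ Δ[T] = Δ[S] ≫ (f ⊗ₘ f))
    (r : T ⟶ C.bang X) (w : T ⟶ X) : f ≫ lie r w = lie (f ≫ r) (f ≫ w) := by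
  rw [lie, lie, reassoc_of% hf, tensorHom_comp_tensorHom_assoc]

/-- The Euler operator `d° d`. -/
def euler (A : C.Obj) : C.bang A ⟶ C.bang A := lie (𝟙 _) (C.derel A)

theorem euler_counit (A : C.Obj) : euler A ≫ ε[C.bang A] = 0 := lie_counit _ _

theorem euler_derel (A : C.Obj) : euler A ≫ C.derel A = C.derel A := lie_derel _ _

theorem euler_natural {A B : C.Obj} (f : A ⟶ B) : euler A ≫ bangHom f = bangHom f ≫ euler B := by
  rw [euler, euler, lie_bangHom, comp_lie _ (IsComonHom.hom_comul _), bangHom_derel,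
    Category.id_comp, Category.comp_id]

end Lie

section Monoidal

variable {C} (A B : C.Obj)

/-- The cofree-coalgebra structure on a tensor product of exponentials. -/
def tensorDig : C.bang A ⊗ C.bang B ⟶ C.bang (C.bang A ⊗ C.bang B) :=
  (C.dig A ⊗ₘ C.dig B) ≫ C.mon _ _

instance isComonHom_tensorDig : IsComonHom (tensorDig A B) where
  hom_counit := by
    rw [tensorDig, Category.assoc, IsComonHom.hom_counit, Comon.tensorObj_counit,
      Comon.tensorObj_counit, tensorHom_comp_tensorHom_assoc, IsComonHom.hom_counit,
      IsComonHom.hom_counit]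
  hom_comul := by
    rw [tensorDig, Category.assoc, IsComonHom.hom_comul, Comon.tensorObj_comul,
      Comon.tensorObj_comul, ← tensorHom_comp_tensorHom, Category.assoc,
      tensorHom_comp_tensorHom_assoc, IsComonHom.hom_comul, IsComonHom.hom_comul,
      ← tensorHom_comp_tensorHom_assoc, tensorμ_natural_assoc, Category.assoc]

theorem tensorDig_bangHom_fst :
    tensorDig A B ≫ bangHom (comonFst _ _ ≫ C.derel A) = comonFst _ _ := by
  have h : tensorDig A B ≫ bangHom (C.bang A ◁ ε[C.bang B]) ≫ bangHom (ρ_ _).hom =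
      comonFst _ _ ≫ C.dig A := by
    have n := mon_natural (𝟙 (C.bang A)) ε[C.bang B]
    rw [id_tensorHom] at n
    rw [tensorDig, Category.assoc, ← reassoc_of% n, tensorHom_comp_tensorHom_assoc,
      dig_bangHom_counit, bangHom_id, Category.comp_id, MonoidalCategory.tensorHom_def,
      MonoidalCategory.whiskerLeft_comp]
    have u := mon_unit_right (C.bang A)
    rw [Iso.inv_comp_eq, Category.comp_id] at u
    simp only [Category.assoc, comonFst]
    rw [u, ← whisker_exchange_assoc, rightUnitor_naturality]
  rw [bangHom_comp, comonFst, bangHom_comp, Category.assoc, reassoc_of% h, dig_bangHom_derel,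
    Category.comp_id, comonFst]

theorem tensorDig_bangHom_snd :
    tensorDig A B ≫ bangHom (comonSnd _ _ ≫ C.derel B) = comonSnd _ _ := by
  have h : tensorDig A B ≫ bangHom (ε[C.bang A] ▷ C.bang B) ≫ bangHom (λ_ _).hom =
      comonSnd _ _ ≫ C.dig B := by
    have n := mon_natural ε[C.bang A] (𝟙 (C.bang B))
    rw [tensorHom_id] at n
    rw [tensorDig, Category.assoc, ← reassoc_of% n, tensorHom_comp_tensorHom_assoc,
      dig_bangHom_counit, bangHom_id, Category.comp_id, tensorHom_def', comp_whiskerRight]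
    have u := mon_unit_left (C.bang B)
    rw [Iso.inv_comp_eq, Category.comp_id] at u
    simp only [Category.assoc, comonSnd]
    rw [u, whisker_exchange_assoc, leftUnitor_naturality]
  rw [bangHom_comp, comonSnd, bangHom_comp, Category.assoc, reassoc_of% h, dig_bangHom_derel,
    Category.comp_id, comonSnd]

/-- The map `!(!A ⊗ !B) ⟶ !A ⊗ !B` induced by the two projections. -/
def split : C.bang (C.bang A ⊗ C.bang B) ⟶ C.bang A ⊗ C.bang B :=
  Δ[_] ≫ (bangHom (comonFst _ _ ≫ C.derel A) ⊗ₘ bangHom (comonSnd _ _ ≫ C.derel B))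

theorem tensorDig_split : tensorDig A B ≫ split A B = 𝟙 _ := by
  rw [split, reassoc_of% IsComonHom.hom_comul (tensorDig A B), tensorHom_comp_tensorHom,
    tensorDig_bangHom_fst, tensorDig_bangHom_snd, comul_comonFst_comonSnd]

theorem dig_bangHom_natural {A B : C.Obj} (f : A ⟶ B) :
    bangHom f ≫ C.dig B = C.dig A ≫ bangHom (bangHom f) := C.rho_natural f

theorem split_mon : split A B ≫ C.mon A B =
    C.dig _ ≫ bangHom (split A B ≫ (C.derel A ⊗ₘ C.derel B)) := by
  rw [split]
  generalize comonFst (C.bang A) (C.bang B) ≫ C.derel A = f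
  generalize comonSnd (C.bang A) (C.bang B) ≫ C.derel B = g
  rw [Category.assoc, Category.assoc, bangHom_comp, bangHom_comp,
    reassoc_of% dig_bangHom_comul, ← reassoc_of% mon_natural, ← mon_natural,
    tensorHom_comp_tensorHom_assoc, tensorHom_comp_tensorHom_assoc,
    ← dig_bangHom_natural, ← dig_bangHom_natural, Category.assoc, Category.assoc,
    dig_bangHom_derel, dig_bangHom_derel, Category.comp_id, Category.comp_id]

theorem lie_tensorDig_split :
    lie (tensorDig A B) (euler A ▷ C.bang B) ≫ split A B = euler A ▷ C.bang B := by
  have h₁ : euler A ▷ C.bang B ≫ comonFst _ _ ≫ C.derel A = comonFst _ _ ≫ C.derel A := by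
    rw [comonFst, Category.assoc, ← whisker_exchange_assoc, rightUnitor_naturality_assoc,
      euler_derel]
  have h₂ : euler A ▷ C.bang B ≫ comonSnd _ _ ≫ C.derel B = 0 := by
    rw [comonSnd, Category.assoc, ← comp_whiskerRight_assoc, euler_counit, ← tensorHom_id,
      zero_tensorHom, hom_zero_comp]
  rw [split, reassoc_of% lie_comul, hom_add_comp, Category.assoc, Category.assoc,
    tensorHom_comp_tensorHom, tensorHom_comp_tensorHom, lie_bangHom, lie_bangHom, h₁, h₂, lie_zero,
    tensorHom_zero, hom_comp_zero, _root_.add_zero, tensorDig_bangHom_fst, tensorDig_bangHom_snd]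
  have e : lie (comonFst (C.bang A) (C.bang B)) (comonFst _ _ ≫ C.derel A) =
      comonFst _ _ ≫ euler A := by
    rw [euler, comp_lie _ (comonFst_comul _ _), Category.comp_id]
  have f : (comonFst (C.bang A) (C.bang B) ≫ euler A) ⊗ₘ comonSnd (C.bang A) (C.bang B) =
      (comonFst _ _ ⊗ₘ comonSnd _ _) ≫ euler A ▷ C.bang B := by
    rw [← tensorHom_id, tensorHom_comp_tensorHom, Category.comp_id]
  rw [e, f, reassoc_of% comul_comonFst_comonSnd]

theorem euler_whiskerRight_mon :
    euler A ▷ C.bang B ≫ C.mon A B = C.mon A B ≫ euler (A ⊗ B) := by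
  rw [← lie_tensorDig_split, Category.assoc, split_mon,
    reassoc_of% lie_dig (tensorDig A B) (euler A ▷ C.bang B), lie_bangHom,
    Category.assoc, ← split_mon, reassoc_of% tensorDig_split, reassoc_of% lie_tensorDig_split]
  have h : euler A ▷ C.bang B ≫ (C.derel A ⊗ₘ C.derel B) = C.mon A B ≫ C.derel _ := by
    rw [← tensorHom_id, tensorHom_comp_tensorHom, euler_derel, Category.id_comp, mon_derel]
  rw [h, euler, comp_lie _ (IsComonHom.hom_comul _), Category.comp_id]

theorem euler_whiskerLeft_mon :
    C.bang A ◁ euler B ≫ C.mon A B = C.mon A B ≫ euler (A ⊗ B) := by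
  have h := mon_braiding B A
  rw [← cancel_epi (β_ (C.bang B) (C.bang A)).hom,
    ← BraidedCategory.braiding_naturality_left_assoc, h, reassoc_of% h, ← euler_natural,
    reassoc_of% euler_whiskerRight_mon]

end Monoidal

section Unit

/-- The deriving transformation at the unit. -/
def derivUnit : C.bang (𝟙_ C.Obj) ⟶ C.bang (𝟙_ C.Obj) := (ρ_ _).inv ≫ C.deriv (𝟙_ C.Obj)

/-- The coderiving transformation at the unit. -/
def coderivUnit : C.bang (𝟙_ C.Obj) ⟶ C.bang (𝟙_ C.Obj) :=
  Δ[C.bang (𝟙_ C.Obj)] ≫ C.bang (𝟙_ C.Obj) ◁ C.derel (𝟙_ C.Obj) ≫ (ρ_ _).hom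

/-- The map `!(0)` on the exponential of the unit. -/
def bangZero : C.bang (𝟙_ C.Obj) ⟶ C.bang (𝟙_ C.Obj) := bangHom 0

theorem euler_eq (A : C.Obj) :
    euler A = Δ[C.bang A] ≫ C.bang A ◁ C.derel A ≫ C.deriv A := by
  rw [euler, lie, id_tensorHom]

theorem coderivUnit_derivUnit : C.coderivUnit ≫ C.derivUnit = euler (𝟙_ C.Obj) := by
  rw [coderivUnit, derivUnit, euler_eq]
  simp

theorem dcirc_der_eq_euler (A : C.Obj) : C.comp (C.dcirc A) (C.der A) = euler A := by
  rw [euler_eq]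
  exact C.comp_assoc _ _ _

theorem dR_eq : C.dR = C.derivUnit := rfl

theorem dcircR_eq : C.dcircR = C.coderivUnit := C.comp_assoc _ _ _

theorem derivUnit_coderivUnit :
    C.derivUnit ≫ C.coderivUnit = euler (𝟙_ C.Obj) + 𝟙 _ := by
  have h₁ : (ρ_ (C.bang (𝟙_ C.Obj))).inv ≫ Δ[C.bang (𝟙_ C.Obj)] ▷ 𝟙_ C.Obj ≫ (α_ _ _ _).hom ≫
      C.bang (𝟙_ C.Obj) ◁ (β_ (C.bang (𝟙_ C.Obj)) (𝟙_ C.Obj)).hom ≫ (α_ _ _ _).inv ≫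
      C.deriv (𝟙_ C.Obj) ▷ C.bang (𝟙_ C.Obj) ≫ C.bang (𝟙_ C.Obj) ◁ C.derel (𝟙_ C.Obj) ≫
      (ρ_ _).hom = C.coderivUnit ≫ C.derivUnit := by
    rw [← whisker_exchange_assoc, rightUnitor_naturality, coderivUnit, derivUnit,
      braiding_tensorUnit_right]
    simp only [Category.assoc]
    rw [← rightUnitor_inv_naturality_assoc]
    congr 1
    simp
  have h₂ : (ρ_ (C.bang (𝟙_ C.Obj))).inv ≫ Δ[C.bang (𝟙_ C.Obj)] ▷ 𝟙_ C.Obj ≫ (α_ _ _ _).hom ≫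
      C.bang (𝟙_ C.Obj) ◁ C.deriv (𝟙_ C.Obj) ≫ C.bang (𝟙_ C.Obj) ◁ C.derel (𝟙_ C.Obj) ≫
      (ρ_ _).hom = 𝟙 _ := by
    rw [← MonoidalCategory.whiskerLeft_comp_assoc, deriv_derel,
      ← rightUnitor_inv_naturality_assoc]
    have h : (ρ_ (C.bang (𝟙_ C.Obj) ⊗ C.bang (𝟙_ C.Obj))).inv ≫ (α_ _ _ _).hom ≫
        C.bang (𝟙_ C.Obj) ◁ (ε[C.bang (𝟙_ C.Obj)] ▷ 𝟙_ C.Obj ≫ (λ_ (𝟙_ C.Obj)).hom) ≫ (ρ_ _).hom =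
        C.bang (𝟙_ C.Obj) ◁ ε[C.bang (𝟙_ C.Obj)] ≫ (ρ_ _).hom := by
      simp [unitors_equal]
    rw [h, ComonObj.comul_counit_assoc, Iso.inv_hom_id]
  rw [← coderivUnit_derivUnit, ← h₁, ← h₂, derivUnit]
  conv_lhs => rw [coderivUnit]
  rw [Category.assoc, reassoc_of% deriv_comul]
  simp only [hom_add_comp, hom_comp_add, Category.assoc]

theorem derivUnit_bangZero : C.derivUnit ≫ C.bangZero = 0 := by
  rw [derivUnit, bangZero, Category.assoc, ← deriv_natural, tensorHom_zero, hom_zero_comp,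
    hom_comp_zero]

theorem bangZero_coderivUnit : C.bangZero ≫ C.coderivUnit = 0 := by
  rw [bangZero, coderivUnit, IsComonHom.hom_comul_assoc, ← id_tensorHom,
    tensorHom_comp_tensorHom_assoc, bangHom_derel, hom_comp_zero, tensorHom_zero, hom_zero_comp,
    hom_comp_zero]

theorem bangZero_bangZero : C.bangZero ≫ C.bangZero = C.bangZero := by
  rw [bangZero, ← bangHom_comp, hom_zero_comp]

theorem monUnit_coderivUnit : C.monUnit ≫ C.coderivUnit = C.monUnit := by
  rw [coderivUnit, reassoc_of% C.monUnit_comul, ← id_tensorHom, tensorHom_comp_tensorHom_assoc,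
    monUnit_derel, Category.comp_id, tensorHom_id, rightUnitor_naturality, ← unitors_equal,
    Iso.inv_hom_id_assoc]

variable {C}
variable {s j : C.bang (𝟙_ C.Obj) ⟶ C.bang (𝟙_ C.Obj)}

theorem comp_euler_add_id (hs : s ≫ C.derivUnit + C.bangZero = 𝟙 _) :
    s ≫ (euler (𝟙_ C.Obj) + 𝟙 _) = C.coderivUnit := by
  have h := congrArg (· ≫ C.coderivUnit) hs
  simpa only [hom_add_comp, bangZero_coderivUnit, _root_.add_zero, Category.assoc,
    derivUnit_coderivUnit, Category.id_comp] using h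

/-- Multiplication by the point `t` of the exponential of the unit. -/
def pointMul (t : 𝟙_ C.Obj ⟶ C.bang (𝟙_ C.Obj)) : C.bang (𝟙_ C.Obj) ⟶ C.bang (𝟙_ C.Obj) :=
  (λ_ _).inv ≫ t ▷ _ ≫ C.mon _ _ ≫ bangHom (λ_ _).hom

theorem pointMul_monUnit : pointMul C.monUnit = 𝟙 _ := mon_unit_left _

theorem pointMul_add (t t' : 𝟙_ C.Obj ⟶ C.bang (𝟙_ C.Obj)) :
    pointMul (t + t') = pointMul t + pointMul t' := by
  simp only [pointMul, hom_add_whiskerRight, hom_add_comp, hom_comp_add]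

theorem pointMul_comp_euler (t : 𝟙_ C.Obj ⟶ C.bang (𝟙_ C.Obj)) :
    pointMul (t ≫ euler _) = pointMul t ≫ euler _ := by
  simp only [pointMul, comp_whiskerRight, Category.assoc]
  rw [← euler_natural, reassoc_of% euler_whiskerRight_mon]

theorem euler_comp_pointMul (t : 𝟙_ C.Obj ⟶ C.bang (𝟙_ C.Obj)) :
    euler _ ≫ pointMul t = pointMul t ≫ euler _ := by
  simp only [pointMul, Category.assoc]
  rw [← euler_natural, ← reassoc_of% euler_whiskerLeft_mon, ← whisker_exchange_assoc,
    leftUnitor_inv_naturality_assoc]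

theorem exists_inverse_euler_add_id (hs : s ≫ C.derivUnit + C.bangZero = 𝟙 _) :
    ∃ g, (euler (𝟙_ C.Obj) + 𝟙 _) ≫ g = 𝟙 _ ∧ g ≫ (euler (𝟙_ C.Obj) + 𝟙 _) = 𝟙 _ := by
  have t : C.monUnit ≫ s ≫ euler _ + C.monUnit ≫ s = C.monUnit := by
    have h := comp_euler_add_id hs
    rw [hom_comp_add, Category.comp_id] at h
    rw [← hom_comp_add, h, monUnit_coderivUnit]
  have h : pointMul (C.monUnit ≫ s) ≫ euler _ + pointMul (C.monUnit ≫ s) = 𝟙 _ := by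
    rw [← pointMul_comp_euler, ← pointMul_add, Category.assoc, t, pointMul_monUnit]
  refine ⟨pointMul (C.monUnit ≫ s), ?_, ?_⟩
  · rw [hom_add_comp, euler_comp_pointMul, Category.id_comp, h]
  · rw [hom_comp_add, Category.comp_id, h]

theorem eq_coderivUnit_comp (hs : s ≫ C.derivUnit + C.bangZero = 𝟙 _)
    (hj : (euler (𝟙_ C.Obj) + 𝟙 _) ≫ j = 𝟙 _) : s = C.coderivUnit ≫ j := by
  rw [← comp_euler_add_id hs, Category.assoc, hj, Category.comp_id]

theorem derivUnit_comp_section (hs : s ≫ C.derivUnit + C.bangZero = 𝟙 _)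
    (hj : (euler (𝟙_ C.Obj) + 𝟙 _) ≫ j = 𝟙 _) : C.derivUnit ≫ s = 𝟙 _ := by
  rw [eq_coderivUnit_comp hs hj, reassoc_of% C.derivUnit_coderivUnit, hj]

theorem bangZero_comp_section (hs : s ≫ C.derivUnit + C.bangZero = 𝟙 _)
    (hj : (euler (𝟙_ C.Obj) + 𝟙 _) ≫ j = 𝟙 _) : C.bangZero ≫ s = 0 := by
  rw [eq_coderivUnit_comp hs hj, reassoc_of% C.bangZero_coderivUnit, hom_zero_comp]

theorem euler_add_bangZero_comp (hs : s ≫ C.derivUnit + C.bangZero = 𝟙 _)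
    (hj : (euler (𝟙_ C.Obj) + 𝟙 _) ≫ j = 𝟙 _) :
    (euler (𝟙_ C.Obj) + C.bangZero) ≫ (s ≫ j ≫ C.derivUnit + C.bangZero) = 𝟙 _ := by
  rw [← coderivUnit_derivUnit, hom_add_comp, hom_comp_add, hom_comp_add, Category.assoc,
    Category.assoc, reassoc_of% derivUnit_comp_section hs hj, derivUnit_bangZero, hom_comp_zero,
    reassoc_of% bangZero_comp_section hs hj, hom_zero_comp, bangZero_bangZero, _root_.add_zero,
    _root_.zero_add, ← Category.assoc, ← eq_coderivUnit_comp hs hj, hs]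

theorem comp_coderivUnit (hj' : j ≫ (euler (𝟙_ C.Obj) + 𝟙 _) = 𝟙 _) :
    (s ≫ j ≫ C.derivUnit + C.bangZero) ≫ C.coderivUnit = s := by
  rw [hom_add_comp, bangZero_coderivUnit, _root_.add_zero, Category.assoc, Category.assoc,
    derivUnit_coderivUnit, hj', Category.comp_id]

theorem comp_euler_add_bangZero (hs : s ≫ C.derivUnit + C.bangZero = 𝟙 _)
    (hj' : j ≫ (euler (𝟙_ C.Obj) + 𝟙 _) = 𝟙 _) :
    (s ≫ j ≫ C.derivUnit + C.bangZero) ≫ (euler (𝟙_ C.Obj) + C.bangZero) = 𝟙 _ := by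
  rw [← coderivUnit_derivUnit, hom_comp_add, reassoc_of% comp_coderivUnit hj', hom_add_comp,
    Category.assoc, Category.assoc, derivUnit_bangZero, hom_comp_zero, hom_comp_zero,
    bangZero_bangZero, _root_.zero_add, hs]

end Unit

end DiffLinCat

/-- Lemma: in a differential linear category, if s_R satisfies [ftc.2]
then J_R is an isomorphism, K_R is an isomorphism with inverse
K_R⁻¹ = s_R J_R⁻¹ d_R + !(0), and s_R = K_R⁻¹ d°_R. -/
theorem statement13 (C : DiffLinCat) (sR : C.Hom (C.bang C.unit) (C.bang C.unit))
    (hftc2 : C.add (C.comp sR C.dR) (C.bangMap (C.zero : C.Hom C.unit C.unit)) =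
      C.id (C.bang C.unit)) :
    (∃ g : C.Hom (C.bang C.unit) (C.bang C.unit),
      C.comp (C.J C.unit) g = C.id (C.bang C.unit) ∧
        C.comp g (C.J C.unit) = C.id (C.bang C.unit)) ∧
    (∀ JRinv : C.Hom (C.bang C.unit) (C.bang C.unit),
      C.comp (C.J C.unit) JRinv = C.id (C.bang C.unit) →
      C.comp JRinv (C.J C.unit) = C.id (C.bang C.unit) →
        (C.comp (C.K C.unit)
            (C.add (C.comp sR (C.comp JRinv C.dR))
              (C.bangMap (C.zero : C.Hom C.unit C.unit))) =
          C.id (C.bang C.unit)) ∧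
        (C.comp
            (C.add (C.comp sR (C.comp JRinv C.dR))
              (C.bangMap (C.zero : C.Hom C.unit C.unit)))
            (C.K C.unit) =
          C.id (C.bang C.unit)) ∧
        (sR = C.comp
            (C.add (C.comp sR (C.comp JRinv C.dR))
              (C.bangMap (C.zero : C.Hom C.unit C.unit)))
            C.dcircR)) := by
  rw [DiffLinCat.J, DiffLinCat.K, C.dcirc_der_eq_euler, C.dR_eq, C.dcircR_eq]
  rw [C.dR_eq] at hftc2
  exact ⟨DiffLinCat.exists_inverse_euler_add_id hftc2, fun j hj hj' =>
    ⟨DiffLinCat.euler_add_bangZero_comp hftc2 hj, DiffLinCat.comp_euler_add_bangZero hftc2 hj',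
      (DiffLinCat.comp_coderivUnit hj').symm⟩⟩
end

section
/- Let R be a commutative semiring in which, for every positive natural number n, the element n (the n-fold sum of 1 in R) is invertible, with inverse n⁻¹. Define functions d, s, z : ℕ × ℕ → R by d(n,m) = m · δ(n+1, m); s(0,m) = 0 and s(n,m) = n⁻¹ · δ(n, m+1) for n ≥ 1; and z(n,m) = δ(n,0) · δ(n,m), where δ is the Kronecker delta (δ(a,b) = 1 if a = b and 0 otherwise). Then for all n, m ∈ ℕ: (∑_{k ∈ Finset.range (n+1)} s(n,k) · d(k,m)) + z(n,m) = δ(n,m). (Note s(n,k) · d(k,m) is nonzero only when k = n − 1, so this finite sum computes the matrix composite s d in the biproduct completion R^Π; the identity expresses s_{unit} d_{unit} + !(0) = identity at the monoidal unit of R^Π.) -/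
/-- At the monoidal unit of the biproduct completion R^Π of a commutative
(complete) semiring R in which every positive natural number is invertible,
the integral s and the derivative d satisfy s d + !(0) = identity, where maps
ℕ → ℕ are R-valued matrices composed by matrix multiplication and the
identity is the Kronecker delta. -/
theorem statement17 (R : Type*) [CommSemiring R] (inv : ℕ → R)
    (hinv : ∀ n : ℕ, 0 < n → (n : R) * inv n = 1)
    (d s z : ℕ × ℕ → R)
    (hd : ∀ n m : ℕ, d (n, m) = (m : R) * (if n + 1 = m then 1 else 0))
    (hs0 : ∀ m : ℕ, s (0, m) = 0)
    (hs : ∀ n m : ℕ, 0 < n → s (n, m) = inv n * (if n = m + 1 then 1 else 0))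
    (hz : ∀ n m : ℕ, z (n, m) =
      (if n = 0 then (1 : R) else 0) * (if n = m then 1 else 0)) :
    ∀ n m : ℕ,
      (∑ k ∈ Finset.range (n + 1), s (n, k) * d (k, m)) + z (n, m) =
        (if n = m then (1 : R) else 0) := by
  rintro (_ | n) m
  · simp [hs0, hz]
  · rw [Finset.sum_eq_single_of_mem n (by simp)
      fun k _ hk => by rw [hs _ _ n.succ_pos, if_neg (by omega), mul_zero, zero_mul]]
    rw [hs _ _ n.succ_pos, hd, hz, if_pos rfl, if_neg n.succ_ne_zero, zero_mul, add_zero, mul_one]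
    split_ifs with h
    · rw [← h, mul_one, mul_comm, hinv _ n.succ_pos]
    · rw [mul_zero, mul_zero]
end
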